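/- Let $d \geq 2$, $\alpha \in (0,1)$, $s \in (0,1)$. Then there is a constant $C$ (depending on $d, \alpha, s$) such that for all $\xi \in \mathbb{R}^d$ with $|\xi| \leq 1$, $\int_{\mathbb{R}^d} \frac{1}{(1+|\xi - \eta|^2)^{d/2+\alpha}} \, |P^\perp_{\xi-\eta}\xi|^2 \, \Big| \frac{1}{|\eta|^{2s}} - \frac{1}{|\xi|^{2s}} \Big| \, d\eta \leq C$. -/

import Mathlib

open MeasureTheory ENNReal
open scoped RealInnerProductSpace

/-- `P^⊥_v x`: the orthogonal projection of `x` onto the hyperplane `v^⊥`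
(action of the matrix `I_d - (v/|v|) ⊗ (v/|v|)` on `x`). -/
noncomputable def Pperp {d : ℕ} (v x : EuclideanSpace ℝ (Fin d)) : EuclideanSpace ℝ (Fin d) :=
  x - (⟪v, x⟫ / ‖v‖ ^ 2) • v

theorem norm_Pperp_le {d : ℕ} (v x : EuclideanSpace ℝ (Fin d)) : ‖Pperp v x‖ ≤ ‖x‖ := by
  rcases eq_or_ne v 0 with rfl | hv
  · simp [Pperp]
  have hv' : ‖v‖ ≠ 0 := norm_ne_zero_iff.mpr hv
  refine le_of_sq_le_sq ?_ (norm_nonneg x)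
  have key : ‖Pperp v x‖ ^ 2 = ‖x‖ ^ 2 - (⟪v, x⟫ / ‖v‖) ^ 2 := by
    rw [Pperp, norm_sub_sq_real, inner_smul_right, norm_smul, mul_pow, Real.norm_eq_abs, sq_abs,
      real_inner_comm]
    field_simp
    ring
  rw [key]
  exact sub_le_self _ (sq_nonneg _)

theorem Pperp_sub_left_eq {d : ℕ} (x y : EuclideanSpace ℝ (Fin d)) :
    Pperp (x - y) x = Pperp (x - y) y := by
  rcases eq_or_ne (x - y) 0 with h | h
  · rw [sub_eq_zero.mp h]
  have hv : ‖x - y‖ ^ 2 ≠ 0 := pow_ne_zero 2 (norm_ne_zero_iff.mpr h)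
  have hinner : ⟪x - y, x⟫ = ⟪x - y, y⟫ + ‖x - y‖ ^ 2 := by
    rw [← real_inner_self_eq_norm_sq, ← inner_add_right, add_sub_cancel]
  rw [Pperp, Pperp, hinner, add_div, div_self hv, add_smul, one_smul]
  abel

theorem sq_mul_rpow_neg_le_one {p a s : ℝ} (hp : 0 ≤ p) (hp1 : p ≤ 1) (hpa : p ≤ a)
    (hs : s ∈ Set.Ioo (0 : ℝ) 1) : p ^ 2 * a ^ (-(2 * s)) ≤ 1 := by
  obtain ⟨hs0, hs1⟩ := hs
  rcases hp.eq_or_lt with rfl | hp0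
  · simp
  have ha0 : 0 < a := hp0.trans_le hpa
  calc p ^ 2 * a ^ (-(2 * s)) ≤ p ^ 2 * p ^ (-(2 * s)) := by
        gcongr ?_ * ?_
        exact Real.rpow_le_rpow_of_nonpos hp0 hpa (by linarith)
    _ = p ^ (2 - 2 * s) := by
        rw [← Real.rpow_natCast p 2, ← Real.rpow_add hp0]
        norm_num [sub_eq_add_neg]
    _ ≤ 1 := Real.rpow_le_one hp hp1 (by linarith)

theorem norm_Pperp_sq_mul_abs_rpow_sub_le_two {d : ℕ} {s : ℝ} (hs : s ∈ Set.Ioo (0 : ℝ) 1)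
    {ξ : EuclideanSpace ℝ (Fin d)} (hξ : ‖ξ‖ ≤ 1) (η : EuclideanSpace ℝ (Fin d)) :
    ‖Pperp (ξ - η) ξ‖ ^ 2 * |‖η‖ ^ (-(2 * s)) - ‖ξ‖ ^ (-(2 * s))| ≤ 2 := by
  have hPξ : ‖Pperp (ξ - η) ξ‖ ≤ ‖ξ‖ := norm_Pperp_le _ _
  have hPη : ‖Pperp (ξ - η) ξ‖ ≤ ‖η‖ := Pperp_sub_left_eq ξ η ▸ norm_Pperp_le _ _
  have h1 := sq_mul_rpow_neg_le_one (norm_nonneg _) (hPξ.trans hξ) hPη hs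
  have h2 := sq_mul_rpow_neg_le_one (norm_nonneg _) (hPξ.trans hξ) hPξ hs
  have hη0 : 0 ≤ ‖η‖ ^ (-(2 * s)) := by positivity
  have hξ0 : 0 ≤ ‖ξ‖ ^ (-(2 * s)) := by positivity
  calc _ ≤ ‖Pperp (ξ - η) ξ‖ ^ 2 * (‖η‖ ^ (-(2 * s)) + ‖ξ‖ ^ (-(2 * s))) := by
        gcongr
        exact abs_le.mpr ⟨by linarith, by linarith⟩
    _ ≤ 2 := by linarith

theorem stmt9 (d : ℕ) (hd : 2 ≤ d) (α s : ℝ) (hα : α ∈ Set.Ioo (0 : ℝ) 1)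
    (hs : s ∈ Set.Ioo (0 : ℝ) 1) :
    ∃ C : ℝ, 0 < C ∧
      ∀ ξ : EuclideanSpace ℝ (Fin d), ‖ξ‖ ≤ 1 →
        ∫⁻ η : EuclideanSpace ℝ (Fin d),
            ENNReal.ofReal ((1 + ‖ξ - η‖ ^ 2) ^ (-((d : ℝ) / 2 + α)) *
              ‖Pperp (ξ - η) ξ‖ ^ 2 * |‖η‖ ^ (-(2 * s)) - ‖ξ‖ ^ (-(2 * s))|) ≤
          ENNReal.ofReal C := by
  let w : EuclideanSpace ℝ (Fin d) → ℝ := fun x ↦ (1 + ‖x‖ ^ 2) ^ (-((d : ℝ) / 2 + α)) * 2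
  have hw : Integrable w := by
    have h := integrable_rpow_neg_one_add_norm_sq (E := EuclideanSpace ℝ (Fin d))
      (μ := volume) (r := d + 2 * α) (by simpa using hα.1)
    have hexp : -((d : ℝ) + 2 * α) / 2 = -((d : ℝ) / 2 + α) := by ring
    rw [hexp] at h
    exact h.mul_const 2
  have hw0 : ∀ x, 0 ≤ w x := fun x ↦ by positivity
  refine ⟨(∫ x, w x) + 1, by linarith [integral_nonneg (μ := volume) (f := w) hw0], fun ξ hξ ↦ ?_⟩
  calc _ ≤ ∫⁻ η, ENNReal.ofReal (w (ξ - η)) := by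
        refine lintegral_mono fun η ↦ ENNReal.ofReal_le_ofReal ?_
        rw [mul_assoc]
        exact mul_le_mul_of_nonneg_left (norm_Pperp_sq_mul_abs_rpow_sub_le_two hs hξ η)
          (by positivity)
    _ = ∫⁻ x, ENNReal.ofReal (w x) :=
        lintegral_sub_left_eq_self (fun x ↦ ENNReal.ofReal (w x)) ξ
    _ = ENNReal.ofReal (∫ x, w x) :=
        (ofReal_integral_eq_lintegral_ofReal hw (.of_forall hw0)).symm
    _ ≤ _ := ENNReal.ofReal_le_ofReal (by linarith)
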